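/- arXiv:1710.02928 — 5 statements merged into one kernel-verified Lean document; each statement's English description precedes it below -/
import Mathlib

section
/- Let N and L be positive integers, let S be an N x N positive definite Hermitian complex matrix, let Z be an N x L complex matrix, and let p be a nonzero vector in C^N. Define kappa(p) = 1/(p^H S^{-1} p), alpha_hat = kappa(p) * (p^H S^{-1} Z)^T in C^L, u = Z^H S^{-1} p, and X = I_L + Z^H S^{-1} Z. Then det(S + (Z - p * alpha_hat^T)(Z - p * alpha_hat^T)^H) = det(S) * det(X) * (1 - kappa(p) * u^H X^{-1} u). -/
open Matrix
open scoped ComplexOrder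

/-- Rank-one determinant update, with the update written as a scaled outer product. -/
theorem det_sub_smul_vecMulVec {n R : Type*} [Fintype n] [DecidableEq n] [CommRing R]
    {A : Matrix n n R} (hA : IsUnit A.det) (c : R) (v w : n → R) :
    (A - c • vecMulVec v w).det = A.det * (1 - c * (w ⬝ᵥ A⁻¹ *ᵥ v)) := by
  have h : A - c • vecMulVec v w
      = A + replicateCol Unit (-c • v) * replicateRow Unit w := by
    rw [← vecMulVec_eq, smul_vecMulVec, neg_smul, sub_eq_add_neg]
  rw [h, det_add_replicateCol_mul_replicateRow hA, det_unique (n := Unit), Matrix.add_apply,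
    one_apply_eq, Matrix.mul_assoc, ← replicateCol_mulVec, mulVec_smul]
  simp [replicateRow_mul_replicateCol_apply, sub_eq_add_neg]

/-- Removing the weighted projection of `Z` on `p` from the Gram matrix `Zᴴ T Z`. -/
theorem gram_sub_vecMulVec {m n : Type*} [Fintype m] {T : Matrix m m ℂ} (hT : T.IsHermitian)
    (Z : Matrix m n ℂ) (p : m → ℂ) {κ : ℂ} (hκ : star κ = κ)
    (hκp : κ * (star p ⬝ᵥ T *ᵥ p) = 1) :
    (Z - vecMulVec p (κ • star ((Zᴴ * T) *ᵥ p)))ᴴ * T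
        * (Z - vecMulVec p (κ • star ((Zᴴ * T) *ᵥ p)))
      = Zᴴ * T * Z - κ • vecMulVec ((Zᴴ * T) *ᵥ p) (star ((Zᴴ * T) *ᵥ p)) := by
  have hu : star p ᵥ* T ᵥ* Z = star ((Zᴴ * T) *ᵥ p) := by
    rw [star_mulVec, conjTranspose_mul, conjTranspose_conjTranspose, hT.eq, vecMul_vecMul]
  set u := (Zᴴ * T) *ᵥ p with hu_def
  have hW : (Z - vecMulVec p (κ • star u))ᴴ = Zᴴ - κ • vecMulVec u (star p) := by
    rw [conjTranspose_sub, conjTranspose_vecMulVec, star_smul, star_star, hκ, smul_vecMulVec]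
  have hp : vecMulVec u (star p) * T * vecMulVec p (κ • star u) = vecMulVec u (star u) := by
    rw [vecMulVec_mul, vecMulVec_mul_vecMulVec, ← dotProduct_mulVec, smul_smul,
      mul_comm _ κ, hκp, one_smul]
  rw [hW, Matrix.sub_mul, Matrix.sub_mul, Matrix.mul_sub, Matrix.mul_sub, smul_mul, smul_mul,
    smul_mul, hp, mul_vecMulVec, ← hu_def, vecMulVec_mul, vecMulVec_mul, hu, vecMulVec_smul]
  abel

/-- Identity (46) of Appendix A:
`det(S + (Z - p α̂ᵀ)(Z - p α̂ᵀ)ᴴ) = det S · det X · (1 - κ(p) uᴴ X⁻¹ u)`, where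
`κ(p) = 1/(pᴴ S⁻¹ p)`, `α̂ = κ(p) (pᴴ S⁻¹ Z)ᵀ`, `u = Zᴴ S⁻¹ p`, `X = I_L + Zᴴ S⁻¹ Z`. -/
theorem det_denominator_closed_form
    (N L : ℕ) (hN : 0 < N) (hL : 0 < L)
    (S : Matrix (Fin N) (Fin N) ℂ) (hS : S.PosDef)
    (Z : Matrix (Fin N) (Fin L) ℂ)
    (p : Fin N → ℂ) (hp : p ≠ 0)
    (κ : ℂ) (hκ : κ = (star p ⬝ᵥ S⁻¹ *ᵥ p)⁻¹)
    (αhat : Fin L → ℂ) (hα : αhat = κ • (star p ᵥ* (S⁻¹ * Z)))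
    (u : Fin L → ℂ) (hu : u = (Zᴴ * S⁻¹) *ᵥ p)
    (X : Matrix (Fin L) (Fin L) ℂ) (hX : X = 1 + Zᴴ * S⁻¹ * Z) :
    (S + (Z - vecMulVec p αhat) * (Z - vecMulVec p αhat)ᴴ).det
      = S.det * X.det * (1 - κ * (star u ⬝ᵥ X⁻¹ *ᵥ u)) := by
  have hSdet : IsUnit S.det := S.isUnit_iff_isUnit_det.mp hS.isUnit
  have hT : S⁻¹.PosDef := hS.inv
  have hq : 0 < star p ⬝ᵥ S⁻¹ *ᵥ p := hT.dotProduct_mulVec_pos hp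
  have hκp : κ * (star p ⬝ᵥ S⁻¹ *ᵥ p) = 1 := by rw [hκ, inv_mul_cancel₀ hq.ne']
  have hκs : star κ = κ := by
    rw [hκ, star_inv₀, (IsSelfAdjoint.of_nonneg hq.le).star_eq]
  have hα' : αhat = κ • star ((Zᴴ * S⁻¹) *ᵥ p) := by
    rw [hα, star_mulVec, conjTranspose_mul, conjTranspose_conjTranspose, hT.isHermitian.eq]
  have hXdet : IsUnit X.det := by
    rw [← isUnit_iff_isUnit_det, hX]
    exact (PosDef.one.add_posSemidef (hT.posSemidef.conjTranspose_mul_mul_same Z)).isUnit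
  rw [det_add_mul _ _ hSdet, hα', gram_sub_vecMulVec hT.isHermitian Z p hκs hκp, ← hu,
    ← add_sub_assoc, ← hX, det_sub_smul_vecMulVec hXdet, mul_assoc]
end

section
/- Let N and L be positive integers, let S be an N x N positive definite Hermitian complex matrix, let Z be an N x L complex matrix, and let p be a nonzero vector in C^N. Define kappa(p) = 1/(p^H S^{-1} p), u = Z^H S^{-1} p, and X = I_L + Z^H S^{-1} Z. Then 0 <= kappa(p) * u^H X^{-1} u < 1. -/
open Matrix
open scoped ComplexOrder

/-- If `w` solves the normal equation `(1 + Zᴴ A Z) w = Zᴴ A p` with `A` positive definite and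
`p ≠ 0`, then `(Zᴴ A p)ᴴ w < pᴴ A p`. -/
lemma star_dotProduct_lt_of_normal_equation {m n : Type*} [Fintype m] [Fintype n] [DecidableEq n]
    {A : Matrix m m ℂ} (hA : A.PosDef) (Z : Matrix m n ℂ) {p : m → ℂ} (hp : p ≠ 0) {w : n → ℂ}
    (hw : (1 + Zᴴ * A * Z) *ᵥ w = (Zᴴ * A) *ᵥ p) :
    star ((Zᴴ * A) *ᵥ p) ⬝ᵥ w < star p ⬝ᵥ A *ᵥ p := by
  obtain ⟨q, hq⟩ : ∃ q, q = p - Z *ᵥ w := ⟨_, rfl⟩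
  have hpq : p = q + Z *ᵥ w := by rw [hq]; abel
  have hwq : w = Zᴴ *ᵥ (A *ᵥ q) := by
    rw [add_mulVec, one_mulVec, ← mulVec_mulVec, ← mulVec_mulVec] at hw
    rw [hq, mulVec_sub, mulVec_sub]
    rw [← mulVec_mulVec] at hw
    exact eq_sub_of_add_eq hw
  have hq0 : q ≠ 0 := by
    intro h
    apply hp
    rw [hpq, hwq, h]
    simp
  have hu : star ((Zᴴ * A) *ᵥ p) ⬝ᵥ w = star p ⬝ᵥ A *ᵥ (Z *ᵥ w) := by
    rw [star_mulVec, conjTranspose_mul, conjTranspose_conjTranspose, hA.isHermitian.eq,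
      ← dotProduct_mulVec, mulVec_mulVec]
  have hsplit : star p ⬝ᵥ A *ᵥ p - star p ⬝ᵥ A *ᵥ (Z *ᵥ w)
      = star q ⬝ᵥ A *ᵥ q + star w ⬝ᵥ w := by
    have hww : star w ⬝ᵥ w = star (Z *ᵥ w) ⬝ᵥ A *ᵥ q := by
      rw [star_mulVec, ← dotProduct_mulVec, ← hwq]
    rw [← dotProduct_sub, ← mulVec_sub, ← hq, hww, ← add_dotProduct, ← star_add, ← hpq]
  rw [hu, ← sub_pos, hsplit]
  exact add_pos_of_pos_of_nonneg (hA.dotProduct_mulVec_pos hq0) (dotProduct_star_self_nonneg w)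

/-- The GLRT statistic `κ(p) uᴴ X⁻¹ u` is a real number lying in `[0, 1)`, where
`κ(p) = 1/(pᴴ S⁻¹ p)`, `u = Zᴴ S⁻¹ p`, and `X = I_L + Zᴴ S⁻¹ Z`. -/
theorem glrt_statistic_mem_Ico
    (N L : ℕ) (hN : 0 < N) (hL : 0 < L)
    (S : Matrix (Fin N) (Fin N) ℂ) (hS : S.PosDef)
    (Z : Matrix (Fin N) (Fin L) ℂ)
    (p : Fin N → ℂ) (hp : p ≠ 0)
    (κ : ℂ) (hκ : κ = (star p ⬝ᵥ S⁻¹ *ᵥ p)⁻¹)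
    (u : Fin L → ℂ) (hu : u = (Zᴴ * S⁻¹) *ᵥ p)
    (X : Matrix (Fin L) (Fin L) ℂ) (hX : X = 1 + Zᴴ * S⁻¹ * Z) :
    (κ * (star u ⬝ᵥ X⁻¹ *ᵥ u)).im = 0 ∧
      0 ≤ (κ * (star u ⬝ᵥ X⁻¹ *ᵥ u)).re ∧
      (κ * (star u ⬝ᵥ X⁻¹ *ᵥ u)).re < 1 := by
  have hA : S⁻¹.PosDef := hS.inv
  have hXpos : X.PosDef :=
    hX ▸ PosDef.one.add_posSemidef (hA.posSemidef.conjTranspose_mul_mul_same Z)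
  have hpos : 0 < star p ⬝ᵥ S⁻¹ *ᵥ p := hA.dotProduct_mulVec_pos hp
  have hnonneg : 0 ≤ star u ⬝ᵥ X⁻¹ *ᵥ u := hXpos.inv.posSemidef.dotProduct_mulVec_nonneg u
  have hw : (1 + Zᴴ * S⁻¹ * Z) *ᵥ (X⁻¹ *ᵥ u) = (Zᴴ * S⁻¹) *ᵥ p := by
    rw [← hX, ← hu, mulVec_mulVec,
      mul_nonsing_inv _ ((isUnit_iff_isUnit_det X).1 hXpos.isUnit), one_mulVec]
  have hlt := star_dotProduct_lt_of_normal_equation hA Z hp hw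
  rw [← hu] at hlt
  rw [hκ]
  have h0 := mul_nonneg (inv_nonneg.2 hpos.le) hnonneg
  have h1 := mul_lt_mul_of_pos_left hlt (inv_pos.2 hpos)
  rw [inv_mul_cancel₀ hpos.ne'] at h1
  rw [Complex.le_def] at h0
  rw [Complex.lt_def] at h1
  exact ⟨h0.2.symm, h0.1, h1.1⟩
end

section
/- Let N and L be positive integers, let S be an N x N positive definite Hermitian complex matrix, let Z be an N x L complex matrix, and let d_max be the largest eigenvalue of Upsilon = Z^H S^{-1} Z. Then for every nonzero vector p in C^N, kappa(p) * p^H S^{-1} Z (I_L + Upsilon)^{-1} Z^H S^{-1} p <= d_max / (1 + d_max), where kappa(p) = 1/(p^H S^{-1} p). -/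
open Matrix
open scoped ComplexOrder

/-- The largest eigenvalue bounds the Rayleigh quotient of a Hermitian matrix. -/
theorem Matrix.IsHermitian.posSemidef_smul_one_sub {n 𝕜 : Type*} [Fintype n] [DecidableEq n]
    [RCLike 𝕜] {A : Matrix n n 𝕜} (hA : A.IsHermitian) {d : ℝ}
    (hd : ∀ i, hA.eigenvalues i ≤ d) : ((d : 𝕜) • (1 : Matrix n n 𝕜) - A).PosSemidef := by
  have hD : (diagonal fun i => (d : 𝕜) - (hA.eigenvalues i : 𝕜)).PosSemidef := by
    refine PosSemidef.diagonal fun i => ?_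
    rw [Pi.zero_apply, ← RCLike.ofReal_sub, RCLike.ofReal_nonneg]
    exact sub_nonneg.mpr (hd i)
  have key := hD.mul_mul_conjTranspose_same (hA.eigenvectorUnitary : Matrix n n 𝕜)
  convert key using 1
  have hU : (hA.eigenvectorUnitary : Matrix n n 𝕜) * (hA.eigenvectorUnitary : Matrix n n 𝕜)ᴴ = 1 :=
    Unitary.coe_mul_star_self _
  have hdiag : (diagonal fun i => (d : 𝕜) - (hA.eigenvalues i : 𝕜)) =
      (d : 𝕜) • (1 : Matrix n n 𝕜) - diagonal (RCLike.ofReal ∘ hA.eigenvalues) := by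
    rw [smul_one_eq_diagonal, diagonal_sub]
    rfl
  rw [hdiag, mul_sub, sub_mul, mul_smul_comm, smul_mul_assoc, mul_one, hU]
  congr 1
  conv_lhs => rw [hA.spectral_theorem]
  rfl

/-- If `n` is a squared norm, `u` a quadratic form value bounded by `d * n`, and `a, u` satisfy the
Cauchy-Schwarz bound with mixed term `n + u`, then `(n + u) / a` is at most `d / (1 + d)`. -/
theorem inv_mul_add_le_div_one_add {a n u d : ℝ} (ha : 0 < a) (hn : 0 ≤ n) (hu : 0 ≤ u)
    (hd : 0 ≤ d) (hun : u ≤ d * n) (hcs : (n + u) ^ 2 ≤ a * u) :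
    a⁻¹ * (n + u) ≤ d / (1 + d) := by
  rw [inv_mul_eq_div, div_le_div_iff₀ ha (by linarith)]
  rcases (add_nonneg hn hu).eq_or_lt with h | h
  · rw [← h]
    nlinarith
  · refine le_of_mul_le_mul_left ?_ h
    nlinarith [mul_le_mul_of_nonneg_left hcs (by linarith : 0 ≤ 1 + d),
      mul_le_mul_of_nonneg_left hun ha.le]

theorem Matrix.IsHermitian.star_dotProduct_mulVec {n R : Type*} [Fintype n] [CommSemiring R]
    [StarRing R] {A : Matrix n n R} (hA : A.IsHermitian) (x y : n → R) :
    star (star x ⬝ᵥ A *ᵥ y) = star y ⬝ᵥ A *ᵥ x := by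
  rw [star_dotProduct y, star_mulVec, hA.eq, dotProduct_mulVec]

/-- Cauchy-Schwarz for a positive definite form when the mixed term is real. -/
theorem Matrix.PosDef.sq_le_mul_of_dotProduct_eq_ofReal {n : Type*} [Fintype n]
    {A : Matrix n n ℂ} (hA : A.PosDef) {x y : n → ℂ} (hx : x ≠ 0) {q : ℝ}
    (hq : star x ⬝ᵥ A *ᵥ y = q) :
    q ^ 2 ≤ (star x ⬝ᵥ A *ᵥ x).re * (star y ⬝ᵥ A *ᵥ y).re := by
  have ha : 0 < (star x ⬝ᵥ A *ᵥ x).re := (Complex.pos_iff.mp (hA.dotProduct_mulVec_pos hx)).1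
  have hq' : star y ⬝ᵥ A *ᵥ x = q := by
    rw [← hA.isHermitian.star_dotProduct_mulVec, hq, Complex.star_def, Complex.conj_ofReal]
  set a := (star x ⬝ᵥ A *ᵥ x).re with hadef
  have h := (Complex.nonneg_iff.mp
    (hA.posSemidef.dotProduct_mulVec_nonneg (((q / a : ℝ) : ℂ) • x - y))).1
  simp only [star_sub, star_smul, mulVec_sub, mulVec_smul, sub_dotProduct, dotProduct_sub,
    smul_dotProduct, dotProduct_smul, hq, hq', smul_eq_mul, Complex.sub_re, Complex.star_def,
    Complex.conj_ofReal, Complex.re_ofReal_mul, ← hadef, Complex.ofReal_re] at h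
  have h2 := mul_nonneg ha.le h
  field_simp at h2
  nlinarith

/-- The MRS statistic `d_max/(1+d_max)` upper-bounds the GLRT statistic: for every
nonzero `p`, `κ(p) pᴴ S⁻¹ Z (I_L + Υ)⁻¹ Zᴴ S⁻¹ p ≤ d_max/(1 + d_max)`, where
`Υ = Zᴴ S⁻¹ Z`, `d_max` is the largest eigenvalue of `Υ`, and `κ(p) = 1/(pᴴ S⁻¹ p)`. -/
theorem glrt_statistic_le_mrs_statistic
    (N L : ℕ) (hN : 0 < N) (hL : 0 < L)
    (S : Matrix (Fin N) (Fin N) ℂ) (hS : S.PosDef)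
    (Z : Matrix (Fin N) (Fin L) ℂ)
    (dmax : ℝ)
    (hd : IsGreatest
      (Set.range (Matrix.isHermitian_conjTranspose_mul_mul Z hS.isHermitian.inv).eigenvalues)
      dmax) :
    ∀ p : Fin N → ℂ, p ≠ 0 →
      ((star p ⬝ᵥ S⁻¹ *ᵥ p)⁻¹ *
          (star p ⬝ᵥ (S⁻¹ * Z * (1 + Zᴴ * S⁻¹ * Z)⁻¹ * Zᴴ * S⁻¹) *ᵥ p)).im = 0 ∧
        ((star p ⬝ᵥ S⁻¹ *ᵥ p)⁻¹ *
          (star p ⬝ᵥ (S⁻¹ * Z * (1 + Zᴴ * S⁻¹ * Z)⁻¹ * Zᴴ * S⁻¹) *ᵥ p)).re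
          ≤ dmax / (1 + dmax) := by
  intro p hp
  have hA : (S⁻¹).PosDef := hS.inv
  have hY : (Zᴴ * S⁻¹ * Z).PosSemidef := hA.posSemidef.conjTranspose_mul_mul_same Z
  have hd0 : 0 ≤ dmax := by
    obtain ⟨i, hi⟩ := hd.1
    exact hi ▸ hY.eigenvalues_nonneg i
  have hR := IsHermitian.posSemidef_smul_one_sub
    (isHermitian_conjTranspose_mul_mul Z hS.isHermitian.inv) fun i => hd.2 ⟨i, rfl⟩
  set Y := Zᴴ * S⁻¹ * Z with hYdef
  have hunit : IsUnit (1 + Y).det :=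
    (Matrix.isUnit_iff_isUnit_det _).mp (PosDef.one.add_posSemidef hY).isUnit
  set w := (1 + Y)⁻¹ *ᵥ (Zᴴ *ᵥ (S⁻¹ *ᵥ p)) with hw
  have hwY : Zᴴ *ᵥ (S⁻¹ *ᵥ p) = w + Y *ᵥ w := by
    have h : (1 + Y) *ᵥ w = Zᴴ *ᵥ (S⁻¹ *ᵥ p) := by
      rw [hw, mulVec_mulVec, mul_nonsing_inv _ hunit, one_mulVec]
    rw [← h, add_mulVec, one_mulVec]
  have hquad : star p ⬝ᵥ (S⁻¹ * Z * (1 + Y)⁻¹ * Zᴴ * S⁻¹) *ᵥ p = star p ⬝ᵥ S⁻¹ *ᵥ (Z *ᵥ w) := by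
    simp only [hw, mulVec_mulVec, Matrix.mul_assoc]
  have hform : star (Z *ᵥ w) ⬝ᵥ S⁻¹ *ᵥ (Z *ᵥ w) = star w ⬝ᵥ Y *ᵥ w := by
    rw [star_mulVec, ← dotProduct_mulVec, hYdef]
    simp only [mulVec_mulVec, Matrix.mul_assoc]
  obtain ⟨a, -, ha⟩ := RCLike.nonneg_iff_exists_ofReal.mp (hA.dotProduct_mulVec_pos hp).le
  obtain ⟨n, hn0, hn⟩ := RCLike.nonneg_iff_exists_ofReal.mp (dotProduct_star_self_nonneg (star w))
  obtain ⟨u, hu0, hu⟩ := RCLike.nonneg_iff_exists_ofReal.mp (hY.dotProduct_mulVec_nonneg w)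
  rw [star_star, dotProduct_comm] at hn
  simp only [Complex.coe_algebraMap] at ha hn hu
  have ha0 : 0 < a := by
    have h := hA.dotProduct_mulVec_pos hp
    rwa [← ha, Complex.zero_lt_real] at h
  have hq : star p ⬝ᵥ S⁻¹ *ᵥ (Z *ᵥ w) = ((n + u : ℝ) : ℂ) := by
    rw [← hA.isHermitian.star_dotProduct_mulVec, star_mulVec, ← dotProduct_mulVec, hwY,
      dotProduct_add, ← hn, ← hu, ← Complex.ofReal_add, Complex.star_def, Complex.conj_ofReal]
  have hcs := hA.sq_le_mul_of_dotProduct_eq_ofReal hp hq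
  rw [hform, ← ha, ← hu, Complex.ofReal_re, Complex.ofReal_re] at hcs
  have hun : u ≤ dmax * n := by
    have h := hR.dotProduct_mulVec_nonneg w
    rw [sub_mulVec, smul_mulVec, one_mulVec, dotProduct_sub, dotProduct_smul, ← hn, ← hu,
      smul_eq_mul] at h
    rw [← sub_nonneg, ← Complex.zero_le_real]
    push_cast
    exact h
  rw [hquad, hq, ← ha, ← Complex.ofReal_inv, ← Complex.ofReal_mul]
  exact ⟨Complex.ofReal_im _, inv_mul_add_le_div_one_add ha0 hn0 hu0 hd0 hun hcs⟩
end

section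
/- Let N and L be positive integers, let S be an N x N positive definite Hermitian complex matrix, let Z be an N x L complex matrix, and let p be a nonzero vector in C^N. Define kappa(p) = 1/(p^H S^{-1} p) and alpha_hat = kappa(p) * (p^H S^{-1} Z)^T in C^L. Then for every alpha in C^L, det(S + (Z - p * alpha^T)(Z - p * alpha^T)^H) >= det(S + (Z - p * alpha_hat^T)(Z - p * alpha_hat^T)^H); that is, alpha_hat minimizes det(R(alpha) + S) over alpha in C^L, where R(alpha) = (Z - p * alpha^T)(Z - p * alpha^T)^H. -/
open Matrix
open scoped ComplexOrder

/-- Adding a nonnegative multiple of the rank-one matrix `b̄ bᵀ` to a positive definite matrix does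
not decrease its determinant. -/
theorem Matrix.PosDef.det_le_det_add_smul_vecMulVec_star_self {n : Type*} [Fintype n]
    [DecidableEq n] {M : Matrix n n ℂ} (hM : M.PosDef) {c : ℂ} (hc : 0 ≤ c) (b : n → ℂ) :
    M.det ≤ (M + c • vecMulVec (star b) b).det := by
  have hu : IsUnit M.det := hM.det_pos.ne'.isUnit
  have hdet : (M + c • vecMulVec (star b) b).det = M.det * (1 + c * (b ⬝ᵥ M⁻¹ *ᵥ star b)) := by
    rw [← smul_vecMulVec, vecMulVec_eq Unit, det_add_mul _ _ hu, Matrix.mul_assoc,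
      det_unique (1 + _ : Matrix Unit Unit ℂ), Matrix.add_apply, Matrix.one_apply_eq,
      ← replicateCol_mulVec, replicateRow_mul_replicateCol_apply, mulVec_smul, dotProduct_smul,
      smul_eq_mul]
  have hq : 0 ≤ b ⬝ᵥ M⁻¹ *ᵥ star b := by
    simpa using hM.inv.posSemidef.dotProduct_mulVec_nonneg (star b)
  rw [hdet]
  exact le_mul_of_one_le_right hM.det_pos.le (le_add_of_nonneg_right (mul_nonneg hc hq))

/-- If the columns of `W` are orthogonal to `p` with respect to the positive definite form `S⁻¹`,
then the determinant of `S + (W - p βᵀ)(W - p βᵀ)ᴴ` is smallest at `β = 0`. -/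
theorem Matrix.PosDef.det_add_mul_conjTranspose_le_of_orthogonal {m n : Type*} [Fintype m]
    [DecidableEq m] [Fintype n] [DecidableEq n] {S : Matrix m m ℂ} (hS : S.PosDef)
    {W : Matrix m n ℂ} {p : m → ℂ} (hW : star p ᵥ* (S⁻¹ * W) = 0) (β : n → ℂ) :
    (S + W * Wᴴ).det ≤ (S + (W - vecMulVec p β) * (W - vecMulVec p β)ᴴ).det := by
  have hu : IsUnit S.det := hS.det_pos.ne'.isUnit
  have hW' : (Wᴴ * S⁻¹) *ᵥ p = 0 := by
    have h := congrArg star hW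
    rwa [star_vecMul, star_star, conjTranspose_mul, hS.inv.isHermitian.eq, star_zero] at h
  have hexp : (W - vecMulVec p β)ᴴ * S⁻¹ * (W - vecMulVec p β) =
      Wᴴ * S⁻¹ * W + (star p ⬝ᵥ S⁻¹ *ᵥ p) • vecMulVec (star β) β := by
    rw [conjTranspose_sub, conjTranspose_vecMulVec, Matrix.sub_mul, Matrix.mul_sub,
      Matrix.sub_mul, Matrix.sub_mul, mul_vecMulVec, hW', Matrix.mul_assoc (vecMulVec _ _),
      vecMulVec_mul, hW, Matrix.mul_assoc (vecMulVec _ _), mul_vecMulVec,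
      vecMulVec_mul_vecMulVec, vecMulVec_smul]
    simp
  have hM : (1 + Wᴴ * S⁻¹ * W).PosDef :=
    PosDef.one.add_posSemidef (hS.inv.posSemidef.conjTranspose_mul_mul_same W)
  rw [det_add_mul _ _ hu, det_add_mul _ _ hu, hexp, ← add_assoc]
  exact mul_le_mul_of_nonneg_left (hM.det_le_det_add_smul_vecMulVec_star_self
    (hS.inv.posSemidef.dotProduct_mulVec_nonneg p) β) hS.det_pos.le

/-- The maximum-likelihood estimate `α̂ = κ(p)(pᴴ S⁻¹ Z)ᵀ` of the range profile minimizes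
`det(R(α) + S)` over `α ∈ ℂ^L`, where `R(α) = (Z - p αᵀ)(Z - p αᵀ)ᴴ`; both determinants
are positive real numbers. -/
theorem alpha_hat_minimizes_det
    (N L : ℕ) (hN : 0 < N) (hL : 0 < L)
    (S : Matrix (Fin N) (Fin N) ℂ) (hS : S.PosDef)
    (Z : Matrix (Fin N) (Fin L) ℂ)
    (p : Fin N → ℂ) (hp : p ≠ 0)
    (κ : ℂ) (hκ : κ = (star p ⬝ᵥ S⁻¹ *ᵥ p)⁻¹)
    (αhat : Fin L → ℂ) (hα : αhat = κ • (star p ᵥ* (S⁻¹ * Z))) :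
    ∀ α : Fin L → ℂ,
      ((S + (Z - vecMulVec p α) * (Z - vecMulVec p α)ᴴ).det).im = 0 ∧
      ((S + (Z - vecMulVec p αhat) * (Z - vecMulVec p αhat)ᴴ).det).im = 0 ∧
      ((S + (Z - vecMulVec p αhat) * (Z - vecMulVec p αhat)ᴴ).det).re
        ≤ ((S + (Z - vecMulVec p α) * (Z - vecMulVec p α)ᴴ).det).re := by
  intro α
  have hc : star p ⬝ᵥ S⁻¹ *ᵥ p ≠ 0 := (hS.inv.dotProduct_mulVec_pos hp).ne'
  have horth : star p ᵥ* (S⁻¹ * (Z - vecMulVec p αhat)) = 0 := by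
    rw [Matrix.mul_sub, vecMul_sub, mul_vecMulVec, vecMul_vecMulVec, hα, hκ, smul_smul,
      mul_inv_cancel₀ hc, one_smul, sub_self]
  have hle := hS.det_add_mul_conjTranspose_le_of_orthogonal horth (α - αhat)
  rw [vecMulVec_sub, sub_sub, add_sub_cancel] at hle
  have him (a : Fin L → ℂ) :
      ((S + (Z - vecMulVec p a) * (Z - vecMulVec p a)ᴴ).det).im = 0 :=
    (Complex.lt_def.1 (hS.add_posSemidef
      (posSemidef_self_mul_conjTranspose (Z - vecMulVec p a))).det_pos).2.symm
  exact ⟨him α, him αhat, (Complex.le_def.1 hle).1⟩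
end

section
/- Let N be a positive integer, let M be a positive integer, and let T be an N x N positive definite Hermitian complex matrix. Then over the set of N x N positive definite Hermitian complex matrices C, the function C -> det(C)^{-M} * exp(-tr(C^{-1} T)) attains its maximum at C = T/M, i.e., for every positive definite Hermitian C, det(C)^{-M} * exp(-tr(C^{-1} T)) <= det(T/M)^{-M} * exp(-N*M). -/
open Matrix
open scoped ComplexOrder

/-- A positive semidefinite matrix `X` of size `n` satisfies `det X * exp (-tr X) ≤ exp (-n)`. -/
lemma Matrix.PosSemidef.det_mul_exp_neg_trace_le {n : Type*} [Fintype n] [DecidableEq n]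
    {X : Matrix n n ℂ} (hX : X.PosSemidef) :
    X.det.re * Real.exp (-X.trace.re) ≤ Real.exp (-(Fintype.card n : ℝ)) := by
  have hdet : X.det.re = ∏ i, hX.1.eigenvalues i := by
    rw [hX.1.det_eq_prod_eigenvalues]
    exact_mod_cast Complex.ofReal_re (∏ i, hX.1.eigenvalues i)
  have htr : X.trace.re = ∑ i, hX.1.eigenvalues i := by
    rw [hX.1.trace_eq_sum_eigenvalues]
    exact_mod_cast Complex.ofReal_re (∑ i, hX.1.eigenvalues i)
  rw [hdet, htr, ← Finset.sum_neg_distrib, Real.exp_sum, ← Finset.prod_mul_distrib]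
  calc ∏ i, hX.1.eigenvalues i * Real.exp (-hX.1.eigenvalues i)
      ≤ ∏ _i : n, Real.exp (-1) := by
        refine Finset.prod_le_prod
          (fun i _ => mul_nonneg (hX.eigenvalues_nonneg i) (Real.exp_pos _).le) fun i _ => ?_
        rw [Real.exp_neg (hX.1.eigenvalues i), ← div_eq_mul_inv, div_le_iff₀ (Real.exp_pos _),
          ← Real.exp_add]
        linarith [Real.add_one_le_exp (-1 + hX.1.eigenvalues i)]
    _ = Real.exp (-(Fintype.card n : ℝ)) := by
        rw [Finset.prod_const, ← Real.exp_nat_mul, Finset.card_univ, mul_neg_one]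

open scoped MatrixOrder in
/-- The product of two positive semidefinite matrices has the determinant and the trace of a
positive semidefinite matrix. -/
lemma Matrix.PosSemidef.exists_det_eq_trace_eq_mul {n : Type*} [Fintype n] [DecidableEq n]
    {A S : Matrix n n ℂ} (hA : A.PosSemidef) (hS : S.PosSemidef) :
    ∃ X : Matrix n n ℂ, X.PosSemidef ∧ X.det = (A * S).det ∧ X.trace = (A * S).trace := by
  obtain ⟨B, rfl⟩ := CStarAlgebra.nonneg_iff_eq_star_mul_self.mp hA.nonneg
  rw [star_eq_conjTranspose]
  refine ⟨B * S * Bᴴ, hS.mul_mul_conjTranspose_same B, ?_, ?_⟩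
  · simp only [det_mul]
    ring
  · rw [trace_mul_comm, ← Matrix.mul_assoc]

lemma Matrix.PosDef.inv_det_mul_exp_neg_trace_le {n : Type*} [Fintype n] [DecidableEq n]
    {C S : Matrix n n ℂ} (hC : C.PosDef) (hS : S.PosDef) :
    C.det.re⁻¹ * Real.exp (-(C⁻¹ * S).trace.re) ≤
      S.det.re⁻¹ * Real.exp (-(Fintype.card n : ℝ)) := by
  obtain ⟨X, hX, hdet, htr⟩ :=
    hC.posSemidef.inv.exists_det_eq_trace_eq_mul hS.posSemidef
  have hc := Complex.pos_iff.mp hC.det_pos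
  have hs := Complex.pos_iff.mp hS.det_pos
  have hXdet : X.det.re = C.det.re⁻¹ * S.det.re := by
    have hc' : C.det = (C.det.re : ℂ) := Complex.ext rfl (by simp [← hc.2])
    rw [hdet, det_mul, det_nonsing_inv, Ring.inverse_eq_inv', hc', ← Complex.ofReal_inv,
      Complex.re_ofReal_mul, Complex.ofReal_re]
  have h := hX.det_mul_exp_neg_trace_le
  rw [hXdet, htr] at h
  rw [inv_mul_eq_div S.det.re, le_div_iff₀ hs.1]
  linarith

/-- The maximum likelihood estimate of the Gaussian noise covariance matrix: over positive
definite Hermitian `C`, the function `C ↦ det(C)^{-M} exp(-tr(C⁻¹ T))` is maximized at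
`C = T/M`, i.e. `det(C)^{-M} exp(-tr(C⁻¹ T)) ≤ det(T/M)^{-M} exp(-N M)` for all such `C`. -/
theorem covariance_mle
    (N M : ℕ) (hN : 0 < N) (hM : 0 < M)
    (T : Matrix (Fin N) (Fin N) ℂ) (hT : T.PosDef) :
    ∀ C : Matrix (Fin N) (Fin N) ℂ, C.PosDef →
      (C.det.re) ^ (-(M : ℤ)) * Real.exp (-((C⁻¹ * T).trace).re)
        ≤ ((((M : ℂ)⁻¹ • T).det).re) ^ (-(M : ℤ)) * Real.exp (-(N * M : ℝ)) := by
  intro C hC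
  have hM' : (0 : ℂ) < (M : ℂ)⁻¹ := inv_pos.mpr (by exact_mod_cast hM)
  have hS : ((M : ℂ)⁻¹ • T).PosDef := hT.smul hM'
  have hMT : T = (M : ℂ) • ((M : ℂ)⁻¹ • T) := by
    rw [smul_smul, mul_inv_cancel₀ (by exact_mod_cast hM.ne'), one_smul]
  have htr : (C⁻¹ * T).trace.re = M * (C⁻¹ * ((M : ℂ)⁻¹ • T)).trace.re := by
    conv_lhs => rw [hMT, Matrix.mul_smul, trace_smul, smul_eq_mul]
    simp
  have hc := (Complex.pos_iff.mp hC.det_pos).1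
  have h := pow_le_pow_left₀ (by positivity) (hC.inv_det_mul_exp_neg_trace_le hS) M
  rw [mul_pow, mul_pow, ← Real.exp_nat_mul, ← Real.exp_nat_mul, Fintype.card_fin, mul_neg,
    mul_neg, ← htr, mul_comm (M : ℝ) N] at h
  simpa only [_root_.zpow_neg, _root_.zpow_natCast, inv_pow] using h
end
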